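/- The k_n-algebra homomorphism r : I_n → I_n defined on generators by r(c^0_{ij}) = c^0_{ij}, r(c^1_{ij}) = c^1_{ij}, and, for p > 1, r(c^p_{ij}) = C_{p−1} Σ_{k_1,…,k_{2p−2}=1}^{n} (−1)^{m_{k_1}+⋯+m_{k_{2p−2}}} c^1_{k_{2p−2} j} c^1_{k_{2p−3} k_{2p−2}} ⋯ c^1_{k_1 k_2} c^1_{i k_1}, takes values in A_n, restricts to the identity on A_n, and commutes with the differential: ∂ ∘ r = r ∘ ∂. Hence r is a DG-algebra retraction of I_n onto its DG-subalgebra A_n. -/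

import Mathlib

/-!
Internal DG-algebra of Ekholm–Ng. Fix a field `K`, `n ≥ 1` and integers `m : Fin n → ℤ`.
`IAlg K n` is the free associative `k_n`-algebra on generators `c^p_{ij}` (with
`c^0_{ij} = 0` for `i ≥ j`), realised as a quotient of the free `K`-algebra on the
generators together with the orthogonal idempotents `e i` spanning `k_n`.
-/

namespace InternalAlgebra

inductive IGen (n : ℕ) : Type
  | e (i : Fin n) : IGen n
  | c (p : ℕ) (i j : Fin n) : IGen n

open IGen

variable (K : Type) [Field K] (n : ℕ)

/-- Relations defining the free `k_n`-algebra on the generators `c^p_{ij}`: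
the `e i` are orthogonal idempotents summing to `1`, each `c^p_{ij}` satisfies
`e j * c^p_{ij} = c^p_{ij} = c^p_{ij} * e i`, and `c^0_{ij} = 0` unless `i < j`. -/
inductive Rel : FreeAlgebra K (IGen n) → FreeAlgebra K (IGen n) → Prop
  | idem (i : Fin n) :
      Rel (FreeAlgebra.ι K (e i) * FreeAlgebra.ι K (e i)) (FreeAlgebra.ι K (e i))
  | orth (i j : Fin n) (h : i ≠ j) :
      Rel (FreeAlgebra.ι K (e i) * FreeAlgebra.ι K (e j)) 0
  | total : Rel (∑ i : Fin n, FreeAlgebra.ι K (e i)) 1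
  | left (p : ℕ) (i j : Fin n) :
      Rel (FreeAlgebra.ι K (e j) * FreeAlgebra.ι K (c p i j)) (FreeAlgebra.ι K (c p i j))
  | right (p : ℕ) (i j : Fin n) :
      Rel (FreeAlgebra.ι K (c p i j) * FreeAlgebra.ι K (e i)) (FreeAlgebra.ι K (c p i j))
  | czero (i j : Fin n) (h : ¬ i < j) : Rel (FreeAlgebra.ι K (c 0 i j)) 0

/-- The internal algebra `I_n` (as a `K`-algebra; the `k_n`-structure is spanned by
the images of the idempotents `e i`). -/
abbrev IAlg := RingQuot (Rel K n)

/-- The image of a generator in `I_n`. -/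
def ι (g : IGen n) : IAlg K n := RingQuot.mkAlgHom K (Rel K n) (FreeAlgebra.ι K g)

variable (m : Fin n → ℤ)

/-- Degrees of the generators: `|e i| = 0`, `|c^p_{ij}| = 1 - 2p + m j - m i`. -/
def dg : IGen n → ℤ
  | e _ => 0
  | c p i j => 1 - 2 * (p : ℤ) + m j - m i

/-- The homogeneous component of degree `d`: the `K`-span of products of generators
whose degrees sum to `d`. -/
def Hgr (d : ℤ) : Submodule K (IAlg K n) :=
  Submodule.span K
    { x | ∃ l : List (IGen n), (l.map (dg n m)).sum = d ∧ x = (l.map (ι K n)).prod }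

/-- `(-1)^d` as an element of `K`. -/
def sgn (d : ℤ) : K := if Even d then 1 else -1

/-- The prescribed values of the differential on the generators. -/
def Dval : IGen n → IAlg K n
  | e _ => 0
  | c 0 i j =>
      ∑ r : Fin n,
        if i < r ∧ r < j then
          sgn K (m r + m j) • (ι K n (c 0 r j) * ι K n (c 0 i r)) else 0
  | c 1 i j =>
      (if i = j then ι K n (e i) else 0)
      + ∑ r : Fin n,
          ((if i < r then sgn K (m r + m j) • (ι K n (c 1 r j) * ι K n (c 0 i r)) else 0)
            + (if r < j then sgn K (m r + m j) • (ι K n (c 0 r j) * ι K n (c 1 i r)) else 0))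
  | c (p + 2) i j =>
      ∑ q ∈ Finset.range (p + 3), ∑ r : Fin n,
        sgn K (m r + m j) • (ι K n (c (p + 2 - q) r j) * ι K n (c q i r))

/-- The subalgebra `A_n` generated over `k_n` by the `c^0_{ij}` and `c^1_{ij}`. -/
def Asub : Subalgebra K (IAlg K n) :=
  Algebra.adjoin K
    ({x | ∃ i, x = ι K n (e i)} ∪ {x | ∃ i j, x = ι K n (c 0 i j)}
      ∪ {x | ∃ i j, x = ι K n (c 1 i j)})

/-- `D` vanishes on `k_n`, takes the prescribed values on the generators, and satisfies
the graded Leibniz rule. -/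
def IsDiff (D : IAlg K n →ₗ[K] IAlg K n) : Prop :=
  (∀ i : Fin n, D (ι K n (e i)) = 0) ∧
  (∀ (p : ℕ) (i j : Fin n), D (ι K n (c p i j)) = Dval K n m (c p i j)) ∧
  (∀ (d : ℤ) (a b : IAlg K n), a ∈ Hgr K n m d →
    D (a * b) = D a * b + sgn K d • (a * D b))

/-- The composable chain `c^q_{k_L j} ⋯ c^1_{k_1 k_2} c^1_{i k_1}` (leftmost factor has
superscript `q`, all others superscript `1`; multiplications are read right-to-left). -/
def chainQ (q : ℕ) : Fin n → List (Fin n) → Fin n → IAlg K n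
  | i, [], j => ι K n (c q i j)
  | i, k :: ks, j => chainQ q k ks j * ι K n (c 1 i k)

/-- The value of the retraction on `c^p_{ij}` for `p > 1`:
`r(c^p_{ij}) = C_{p−1} Σ_{k_1,…,k_{2p−2}} (−1)^{m_{k_1}+⋯+m_{k_{2p−2}}}
c^1_{k_{2p−2} j} ⋯ c^1_{k_1 k_2} c^1_{i k_1}`. -/
def Rval (p : ℕ) (i j : Fin n) : IAlg K n :=
  (catalan (p - 1) : K) •
    ∑ ks : Fin (2 * (p - 1)) → Fin n,
      sgn K (∑ t, m (ks t)) • chainQ K n 1 i (List.ofFn ks) j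

/-- `r` is the `k_n`-algebra endomorphism of `I_n` fixing `e i`, `c^0_{ij}`, `c^1_{ij}`
and taking the prescribed values on `c^p_{ij}` for `p > 1`. -/
def IsRetr (r : IAlg K n →ₐ[K] IAlg K n) : Prop :=
  (∀ i : Fin n, r (ι K n (e i)) = ι K n (e i)) ∧
  (∀ i j : Fin n, r (ι K n (c 0 i j)) = ι K n (c 0 i j)) ∧
  (∀ i j : Fin n, r (ι K n (c 1 i j)) = ι K n (c 1 i j)) ∧
  (∀ (p : ℕ) (i j : Fin n), 1 < p → r (ι K n (c p i j)) = Rval K n m p i j)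

end InternalAlgebra

namespace InternalAlgebra

open IGen

section Signs

variable (K : Type) [Field K]

lemma sgn_add (a b : ℤ) : sgn K (a + b) = sgn K a * sgn K b := by
  unfold sgn
  by_cases ha : Even a <;> by_cases hb : Even b <;> simp [Int.even_add, ha, hb]

lemma sgn_mul_self (a : ℤ) : sgn K a * sgn K a = 1 := by
  unfold sgn
  split_ifs <;> simp

lemma sgn_zero : sgn K 0 = 1 := by simp [sgn]

lemma sgn_odd_add_sub (p a b : ℤ) :
    sgn K (1 - 2 * p + a - b) = -(sgn K a * sgn K b) := by
  have h : 1 - 2 * p + a - b = (1 + 2 * (-p - b)) + (a + b) := by ring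
  have h1 : sgn K (1 + 2 * (-p - b)) = -1 :=
    if_neg (by simp [Int.even_add])
  rw [h, sgn_add, h1, sgn_add, neg_one_mul]

end Signs

variable {K : Type} [Field K] {n : ℕ}

lemma e_mul_e (i : Fin n) : ι K n (e i) * ι K n (e i) = ι K n (e i) := by
  simpa [ι] using RingQuot.mkAlgHom_rel K (Rel.idem (K := K) i)

lemma e_mul_e_of_ne {i j : Fin n} (h : i ≠ j) : ι K n (e i) * ι K n (e j) = 0 := by
  simpa [ι] using RingQuot.mkAlgHom_rel K (Rel.orth (K := K) i j h)

lemma e_mul_e_eq_ite (i j : Fin n) :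
    ι K n (e i) * ι K n (e j) = if i = j then ι K n (e i) else 0 := by
  split_ifs with h
  · rw [← h, e_mul_e]
  · exact e_mul_e_of_ne h

variable (K n) in
lemma sum_e : ∑ i : Fin n, ι K n (e i) = 1 := by
  simpa [ι] using RingQuot.mkAlgHom_rel K (Rel.total (K := K) (n := n))

lemma e_mul_c (p : ℕ) (i j : Fin n) : ι K n (e j) * ι K n (c p i j) = ι K n (c p i j) := by
  simpa [ι] using RingQuot.mkAlgHom_rel K (Rel.left (K := K) p i j)

lemma c_mul_e (p : ℕ) (i j : Fin n) : ι K n (c p i j) * ι K n (e i) = ι K n (c p i j) := by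
  simpa [ι] using RingQuot.mkAlgHom_rel K (Rel.right (K := K) p i j)

lemma c_zero_of_not_lt {i j : Fin n} (h : ¬ i < j) : ι K n (c 0 i j) = 0 := by
  simpa [ι] using RingQuot.mkAlgHom_rel K (Rel.czero (K := K) i j h)

lemma e_mul_c_eq_ite (p : ℕ) (i j k : Fin n) :
    ι K n (e k) * ι K n (c p i j) = if k = j then ι K n (c p i j) else 0 := by
  rw [← e_mul_c, ← mul_assoc, e_mul_e_eq_ite]
  split_ifs with h
  · rw [h]
  · rw [zero_mul]

lemma c_mul_e_eq_ite (p : ℕ) (i j k : Fin n) :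
    ι K n (c p i j) * ι K n (e k) = if i = k then ι K n (c p i j) else 0 := by
  rw [← c_mul_e, mul_assoc, e_mul_e_eq_ite]
  split_ifs with h
  · rfl
  · rw [mul_zero]

/-- Every element of `I_n` is a linear combination of words in the generators. -/
lemma induction_left {P : IAlg K n → Prop} (h1 : P 1) (hadd : ∀ a b, P a → P b → P (a + b))
    (hsmul : ∀ (t : K) a, P a → P (t • a)) (hmul : ∀ g b, P b → P (ι K n g * b))
    (x : IAlg K n) : P x := by
  obtain ⟨a, rfl⟩ := RingQuot.mkAlgHom_surjective K (Rel K n) x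
  suffices H : ∀ b, P b → P (RingQuot.mkAlgHom K (Rel K n) a * b) by simpa using H 1 h1
  induction a using FreeAlgebra.induction with
  | grade0 t =>
    intro b hb
    rw [AlgHom.commutes, ← Algebra.smul_def]
    exact hsmul t b hb
  | grade1 g => exact fun b hb => hmul g b hb
  | mul a a' iha iha' =>
    intro b hb
    rw [map_mul, mul_assoc]
    exact iha _ (iha' _ hb)
  | add a a' iha iha' =>
    intro b hb
    rw [map_add, add_mul]
    exact hadd _ _ (iha _ hb) (iha' _ hb)

variable (m : Fin n → ℤ)

variable (K) in
/-- The diagonal sign element `∑ i, (-1)^{m i} e i`. -/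
def signElt : IAlg K n := ∑ i, sgn K (m i) • ι K n (e i)

variable (K) in
/-- The total signed generator `∑ i j, (-1)^{m j} c^p_{ij}`. -/
def total (p : ℕ) : IAlg K n := ∑ i, ∑ j, sgn K (m j) • ι K n (c p i j)

lemma e_mul_signElt (i : Fin n) : ι K n (e i) * signElt K m = sgn K (m i) • ι K n (e i) := by
  simp [signElt, Finset.mul_sum, e_mul_e_eq_ite]

lemma signElt_mul_e (i : Fin n) : signElt K m * ι K n (e i) = sgn K (m i) • ι K n (e i) := by
  simp [signElt, Finset.sum_mul, e_mul_e_eq_ite]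

lemma signElt_mul_self : signElt K m * signElt K m = 1 := by
  rw [signElt, Finset.sum_mul, ← sum_e K n]
  refine Finset.sum_congr rfl fun i _ => ?_
  rw [smul_mul_assoc, ← signElt, e_mul_signElt, smul_smul, sgn_mul_self, one_smul]

lemma signElt_mul_c (p : ℕ) (i j : Fin n) :
    signElt K m * ι K n (c p i j) = sgn K (m j) • ι K n (c p i j) := by
  rw [← e_mul_c, ← mul_assoc, signElt_mul_e, smul_mul_assoc]

lemma c_mul_signElt (p : ℕ) (i j : Fin n) :
    ι K n (c p i j) * signElt K m = sgn K (m i) • ι K n (c p i j) := by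
  rw [← c_mul_e, mul_assoc, e_mul_signElt, mul_smul_comm]

lemma total_mul_e (p : ℕ) (i : Fin n) :
    total K m p * ι K n (e i) = ∑ j, sgn K (m j) • ι K n (c p i j) := by
  simp only [total, Finset.sum_mul, smul_mul_assoc, c_mul_e_eq_ite]
  rw [Finset.sum_eq_single i] <;> simp +contextual

lemma e_mul_total_mul_e (p : ℕ) (i j : Fin n) :
    ι K n (e j) * total K m p * ι K n (e i) = sgn K (m j) • ι K n (c p i j) := by
  rw [mul_assoc, total_mul_e]
  simp [Finset.mul_sum, e_mul_c_eq_ite]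

lemma sum_component_mul_component (a b : IAlg K n) (i j : Fin n) :
    ∑ r, sgn K (m r + m j) • ((sgn K (m j) • (ι K n (e j) * a * ι K n (e r))) *
      (sgn K (m r) • (ι K n (e r) * b * ι K n (e i)))) =
      ι K n (e j) * (a * b) * ι K n (e i) := by
  calc _ = ∑ r, ι K n (e j) * a * ι K n (e r) * (b * ι K n (e i)) := by
        refine Finset.sum_congr rfl fun r _ => ?_
        have h : sgn K (m r + m j) * (sgn K (m r) * sgn K (m j)) = 1 := by
          rw [← sgn_add, sgn_mul_self]
        rw [mul_smul_comm, smul_mul_assoc, smul_smul, smul_smul, mul_assoc (sgn K (m r + m j)), h,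
          one_smul]
        simp only [← mul_assoc]
        rw [mul_assoc (ι K n (e j) * a), e_mul_e]
    _ = _ := by
        rw [← Finset.sum_mul, ← Finset.mul_sum, sum_e]
        simp only [mul_assoc, one_mul]

lemma c_eq_component (p : ℕ) (i j : Fin n) :
    ι K n (c p i j) = sgn K (m j) • (ι K n (e j) * total K m p * ι K n (e i)) := by
  rw [e_mul_total_mul_e, smul_smul, sgn_mul_self, one_smul]

lemma sum_c_mul_c (p q : ℕ) (i j : Fin n) :
    ∑ r, sgn K (m r + m j) • (ι K n (c p r j) * ι K n (c q i r)) =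
      ι K n (e j) * (total K m p * total K m q) * ι K n (e i) := by
  rw [← sum_component_mul_component]
  refine Finset.sum_congr rfl fun r _ => ?_
  rw [← c_eq_component, ← c_eq_component]

lemma Dval_one (i j : Fin n) :
    Dval K n m (c 1 i j) = ι K n (e j) *
      (1 + total K m 1 * total K m 0 + total K m 0 * total K m 1) * ι K n (e i) := by
  have h1 : ∀ r, (if i < r then sgn K (m r + m j) • (ι K n (c 1 r j) * ι K n (c 0 i r)) else 0) =
      sgn K (m r + m j) • (ι K n (c 1 r j) * ι K n (c 0 i r)) := by
    intro r
    split_ifs with h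
    · rfl
    · simp [c_zero_of_not_lt h]
  have h2 : ∀ r, (if r < j then sgn K (m r + m j) • (ι K n (c 0 r j) * ι K n (c 1 i r)) else 0) =
      sgn K (m r + m j) • (ι K n (c 0 r j) * ι K n (c 1 i r)) := by
    intro r
    split_ifs with h
    · rfl
    · simp [c_zero_of_not_lt h]
  have h3 : (if i = j then ι K n (e i) else 0) = ι K n (e j) * ι K n (e i) := by
    rw [e_mul_e_eq_ite]
    by_cases h : i = j
    · rw [if_pos h, if_pos h.symm, h]
    · rw [if_neg h, if_neg (Ne.symm h)]
  simp only [Dval, h1, h2, h3, Finset.sum_add_distrib, sum_c_mul_c]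
  noncomm_ring

lemma chainQ_sum (L : ℕ) (i j : Fin n) :
    ∑ ks : Fin L → Fin n, sgn K (∑ t, m (ks t)) • chainQ K n 1 i (List.ofFn ks) j =
      sgn K (m j) • (ι K n (e j) * total K m 1 ^ (L + 1) * ι K n (e i)) := by
  induction L generalizing i with
  | zero => simp [chainQ, sgn_zero, ← c_eq_component]
  | succ L ih =>
    rw [← (Fin.consEquiv fun _ : Fin (L + 1) => Fin n).sum_comp, Fintype.sum_prod_type]
    have h : ∀ k, ∑ ks : Fin L → Fin n,
        sgn K (∑ t, m ((Fin.consEquiv fun _ : Fin (L + 1) => Fin n) (k, ks) t)) •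
          chainQ K n 1 i (List.ofFn ((Fin.consEquiv fun _ : Fin (L + 1) => Fin n) (k, ks))) j =
        sgn K (m j) • (ι K n (e j) * total K m 1 ^ (L + 1) *
          (sgn K (m k) • ι K n (c 1 i k))) := by
      intro k
      have h' := congrArg (fun z => sgn K (m k) • (z * ι K n (c 1 i k))) (ih k)
      simp only [Finset.sum_mul, Finset.smul_sum, smul_mul_assoc, mul_assoc, e_mul_c] at h'
      rw [smul_comm] at h'
      rw [mul_smul_comm, mul_assoc, ← h']
      refine Finset.sum_congr rfl fun ks _ => ?_
      simp [Fin.sum_univ_succ, chainQ, sgn_add, smul_smul]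
    rw [Finset.sum_congr rfl fun k _ => h k, ← Finset.smul_sum, ← Finset.mul_sum, ← total_mul_e,
      pow_succ _ (L + 1)]
    simp only [mul_assoc]

variable (K) in
/-- The image of `total p` under the retraction. -/
def totalRetr : ℕ → IAlg K n
  | 0 => total K m 0
  | q + 1 => (catalan q : K) • total K m 1 ^ (2 * q + 1)

variable (K) in
/-- The values of the retraction on generators. -/
def retrGen : IGen n → IAlg K n
  | e i => ι K n (e i)
  | c p i j => sgn K (m j) • (ι K n (e j) * totalRetr K m p * ι K n (e i))

lemma retrGen_c_zero (i j : Fin n) : retrGen K m (c 0 i j) = ι K n (c 0 i j) :=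
  (c_eq_component m 0 i j).symm

lemma retrGen_c_one (i j : Fin n) : retrGen K m (c 1 i j) = ι K n (c 1 i j) := by
  simp [retrGen, totalRetr, ← c_eq_component]

lemma retrGen_rel {a b : FreeAlgebra K (IGen n)} (h : Rel K n a b) :
    FreeAlgebra.lift K (retrGen K m) a = FreeAlgebra.lift K (retrGen K m) b := by
  induction h with
  | idem i => simp [retrGen, e_mul_e]
  | orth i j h => simp [retrGen, e_mul_e_of_ne h]
  | total => simp [retrGen, sum_e]
  | left p i j => simp [retrGen, ← mul_assoc, e_mul_e]
  | right p i j => simp [retrGen, mul_assoc, e_mul_e]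
  | czero i j h => simp [retrGen_c_zero, c_zero_of_not_lt h]

variable (K) in
/-- The retraction `I_n → I_n`. -/
noncomputable def retr : IAlg K n →ₐ[K] IAlg K n :=
  RingQuot.liftAlgHom K ⟨FreeAlgebra.lift K (retrGen K m), fun _ _ h => retrGen_rel m h⟩

lemma retr_ι (g : IGen n) : retr K m (ι K n g) = retrGen K m g := by
  simp [retr, ι]

lemma Rval_eq (p : ℕ) (i j : Fin n) : Rval K n m (p + 2) i j = retrGen K m (c (p + 2) i j) := by
  rw [Rval, chainQ_sum, retrGen, totalRetr, smul_comm, mul_smul_comm, smul_mul_assoc]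
  rfl

lemma isRetr_retr : IsRetr K n m (retr K m) := by
  refine ⟨fun i => retr_ι m _, fun i j => ?_, fun i j => ?_, fun p i j hp => ?_⟩
  · rw [retr_ι, retrGen_c_zero]
  · rw [retr_ι, retrGen_c_one]
  · obtain ⟨q, rfl⟩ := Nat.exists_eq_add_of_lt hp
    rw [retr_ι, show 1 + q + 1 = q + 2 by ring, Rval_eq]

lemma e_mem_Asub (i : Fin n) : ι K n (e i) ∈ Asub K n :=
  Algebra.subset_adjoin (Or.inl (Or.inl ⟨i, rfl⟩))

lemma c_zero_mem_Asub (i j : Fin n) : ι K n (c 0 i j) ∈ Asub K n :=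
  Algebra.subset_adjoin (Or.inl (Or.inr ⟨i, j, rfl⟩))

lemma c_one_mem_Asub (i j : Fin n) : ι K n (c 1 i j) ∈ Asub K n :=
  Algebra.subset_adjoin (Or.inr ⟨i, j, rfl⟩)

lemma total_mem_Asub {p : ℕ} (h : ∀ i j, ι K n (c p i j) ∈ Asub K n) :
    total K m p ∈ Asub K n :=
  sum_mem fun i _ => sum_mem fun j _ => Subalgebra.smul_mem _ (h i j) _

lemma totalRetr_mem_Asub (p : ℕ) : totalRetr K m p ∈ Asub K n := by
  cases p with
  | zero => exact total_mem_Asub m c_zero_mem_Asub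
  | succ q => exact Subalgebra.smul_mem _ (pow_mem (total_mem_Asub m c_one_mem_Asub) _) _

lemma retrGen_mem_Asub (g : IGen n) : retrGen K m g ∈ Asub K n := by
  cases g with
  | e i => exact e_mem_Asub i
  | c p i j =>
    exact Subalgebra.smul_mem _
      (mul_mem (mul_mem (e_mem_Asub j) (totalRetr_mem_Asub m p)) (e_mem_Asub i)) _

lemma retr_mem_Asub (x : IAlg K n) : retr K m x ∈ Asub K n := by
  induction x using induction_left with
  | h1 => rw [map_one]; exact one_mem _
  | hadd a b ha hb => rw [map_add]; exact add_mem ha hb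
  | hsmul t a ha => rw [map_smul]; exact Subalgebra.smul_mem _ ha t
  | hmul g b hb => rw [map_mul, retr_ι]; exact mul_mem (retrGen_mem_Asub m g) hb

lemma retr_eq_self {x : IAlg K n} (hx : x ∈ Asub K n) : retr K m x = x := by
  have h : Asub K n ≤ AlgHom.equalizer (retr K m) (AlgHom.id K (IAlg K n)) := by
    refine Algebra.adjoin_le ?_
    rintro _ ((⟨i, rfl⟩ | ⟨i, j, rfl⟩) | ⟨i, j, rfl⟩)
    · exact (isRetr_retr m).1 i
    · exact (isRetr_retr m).2.1 i j
    · exact (isRetr_retr m).2.2.1 i j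
  exact h hx

lemma ι_mem_Hgr (g : IGen n) : ι K n g ∈ Hgr K n m (dg n m g) :=
  Submodule.subset_span ⟨[g], by simp, by simp⟩

lemma exists_list_chainQ (i j : Fin n) (ks : List (Fin n)) :
    ∃ l : List (IGen n), (l.map (dg n m)).sum = -(ks.length + 1 : ℤ) + m j - m i ∧
      chainQ K n 1 i ks j = (l.map (ι K n)).prod := by
  induction ks generalizing i with
  | nil => exact ⟨[c 1 i j], by simp [dg], by simp [chainQ]⟩
  | cons k ks ih =>
    obtain ⟨l, hl, hl'⟩ := ih k
    refine ⟨l ++ [c 1 i k], ?_, by simp [chainQ, hl']⟩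
    simp [hl, dg]
    ring

lemma retrGen_mem_Hgr (g : IGen n) : retrGen K m g ∈ Hgr K n m (dg n m g) := by
  match g with
  | e i => exact ι_mem_Hgr m (e i)
  | c 0 i j => rw [retrGen_c_zero]; exact ι_mem_Hgr m _
  | c 1 i j => rw [retrGen_c_one]; exact ι_mem_Hgr m _
  | c (p + 2) i j =>
    rw [← Rval_eq, Rval]
    refine Submodule.smul_mem _ _ (sum_mem fun ks _ => Submodule.smul_mem _ _ ?_)
    obtain ⟨l, hl, hl'⟩ := exists_list_chainQ (K := K) m i j (List.ofFn ks)
    refine Submodule.subset_span ⟨l, ?_, hl'⟩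
    rw [hl, List.length_ofFn, dg]
    push_cast [show p + 2 - 1 = p + 1 by omega]
    ring

section Differential

variable {m} {D : IAlg K n →ₗ[K] IAlg K n} (hD : IsDiff K n m D)
include hD

lemma IsDiff.map_one : D 1 = 0 := by
  rw [← sum_e K n, map_sum]
  exact Finset.sum_eq_zero fun i _ => hD.1 i

lemma IsDiff.map_ι (g : IGen n) : D (ι K n g) = Dval K n m g := by
  cases g with
  | e i => exact hD.1 i
  | c p i j => exact hD.2.1 p i j

lemma IsDiff.map_e_mul (i : Fin n) (b : IAlg K n) : D (ι K n (e i) * b) = ι K n (e i) * D b := by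
  rw [hD.2.2 0 _ b (ι_mem_Hgr m (e i)), hD.1, zero_mul, zero_add, sgn_zero, one_smul]

lemma IsDiff.map_mul_e (b : IAlg K n) (i : Fin n) : D (b * ι K n (e i)) = D b * ι K n (e i) := by
  induction b using induction_left with
  | h1 => rw [one_mul, hD.1, hD.map_one, zero_mul]
  | hadd a b ha hb => rw [add_mul, map_add, ha, hb, map_add, add_mul]
  | hsmul t a ha => rw [smul_mul_assoc, map_smul, ha, map_smul, smul_mul_assoc]
  | hmul g b hb =>
    rw [mul_assoc, hD.2.2 _ _ _ (ι_mem_Hgr m g), hD.2.2 _ _ _ (ι_mem_Hgr m g), hb, add_mul,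
      smul_mul_assoc, mul_assoc, mul_assoc]

/-- The operator `signElt * D` is an odd derivation on the total signed generators. -/
lemma IsDiff.signElt_mul_map_total_mul (p : ℕ) (b : IAlg K n) :
    signElt K m * D (total K m p * b) =
      signElt K m * D (total K m p) * b - total K m p * (signElt K m * D b) := by
  simp only [total, Finset.sum_mul, map_sum, Finset.mul_sum]
  simp only [← Finset.sum_sub_distrib]
  refine Finset.sum_congr rfl fun i _ => Finset.sum_congr rfl fun j _ => ?_
  rw [smul_mul_assoc, map_smul, map_smul, hD.2.2 _ _ _ (ι_mem_Hgr m (c p i j)), dg,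
    sgn_odd_add_sub, smul_mul_assoc, ← mul_assoc _ (signElt K m), c_mul_signElt]
  simp only [mul_smul_comm, smul_mul_assoc, mul_add, mul_neg, ← mul_assoc, signElt_mul_c,
    smul_add, smul_smul]
  rw [sub_eq_add_neg, ← neg_smul]
  congr 2
  linear_combination (-sgn K (m i) * sgn K (m j)) * sgn_mul_self K (m j)

lemma IsDiff.signElt_mul_map_total_one :
    signElt K m * D (total K m 1) =
      1 + total K m 1 * total K m 0 + total K m 0 * total K m 1 := by
  set w := 1 + total K m 1 * total K m 0 + total K m 0 * total K m 1 with hw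
  calc signElt K m * D (total K m 1)
      = ∑ i, ∑ j, ι K n (e j) * w * ι K n (e i) := by
        rw [total]
        simp only [map_sum, Finset.mul_sum]
        refine Finset.sum_congr rfl fun i _ => Finset.sum_congr rfl fun j _ => ?_
        rw [map_smul, hD.map_ι, Dval_one, ← hw, mul_smul_comm, ← mul_assoc, ← mul_assoc,
          signElt_mul_e, smul_mul_assoc, smul_mul_assoc, smul_smul, sgn_mul_self, one_smul]
    _ = w := by
        simp only [← Finset.sum_mul, ← Finset.mul_sum, sum_e, one_mul, mul_one]

lemma IsDiff.signElt_mul_map_total_pow_even (k : ℕ) :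
    signElt K m * D (total K m 1 ^ (2 * k)) =
      total K m 0 * total K m 1 ^ (2 * k) - total K m 1 ^ (2 * k) * total K m 0 := by
  induction k with
  | zero => simp [hD.map_one]
  | succ k ih =>
    rw [show 2 * (k + 1) = 2 * k + 1 + 1 by ring, pow_succ', hD.signElt_mul_map_total_mul,
      pow_succ', hD.signElt_mul_map_total_mul, hD.signElt_mul_map_total_one, ih]
    simp only [add_mul, mul_sub, one_mul, mul_add, mul_assoc]
    abel

lemma IsDiff.signElt_mul_map_total_pow_odd (k : ℕ) :
    signElt K m * D (total K m 1 ^ (2 * k + 1)) = total K m 1 ^ (2 * k) +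
      (total K m 0 * total K m 1 ^ (2 * k + 1) + total K m 1 ^ (2 * k + 1) * total K m 0) := by
  rw [pow_succ', hD.signElt_mul_map_total_mul, hD.signElt_mul_map_total_one,
    hD.signElt_mul_map_total_pow_even]
  simp only [add_mul, mul_sub, one_mul, mul_assoc]
  abel

omit hD in
lemma sum_totalRetr_mul_totalRetr (p : ℕ) :
    ∑ q ∈ Finset.range (p + 3), totalRetr K m (p + 2 - q) * totalRetr K m q =
      (catalan (p + 1) : K) • (total K m 1 ^ (2 * (p + 1)) +
        (total K m 0 * total K m 1 ^ (2 * (p + 1) + 1) +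
          total K m 1 ^ (2 * (p + 1) + 1) * total K m 0)) := by
  have hmid : ∑ q ∈ Finset.range (p + 1),
      totalRetr K m (p + 2 - (q + 1)) * totalRetr K m (q + 1) =
      (catalan (p + 1) : K) • total K m 1 ^ (2 * (p + 1)) := by
    rw [catalan_succ', Finset.Nat.sum_antidiagonal_eq_sum_range_succ_mk, Nat.cast_sum,
      Finset.sum_smul]
    refine Finset.sum_congr rfl fun q hq => ?_
    have hq' : q ≤ p := Nat.lt_succ_iff.mp (Finset.mem_range.mp hq)
    rw [show p + 2 - (q + 1) = (p - q) + 1 by omega]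
    simp only [totalRetr]
    rw [smul_mul_smul_comm, ← pow_add, mul_comm, Nat.cast_mul]
    congr 2
    omega
  rw [Finset.sum_range_succ, Finset.sum_range_succ', hmid, Nat.sub_self, Nat.sub_zero]
  simp only [totalRetr, smul_add, smul_mul_assoc, mul_smul_comm]
  abel

lemma IsDiff.map_retrGen (g : IGen n) : D (retrGen K m g) = retr K m (D (ι K n g)) := by
  match g with
  | e i => rw [retrGen, hD.1, map_zero]
  | c 0 i j =>
    rw [retrGen_c_zero, hD.map_ι]
    simp [Dval, apply_ite (retr K m), retr_ι, retrGen_c_zero]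
  | c 1 i j =>
    rw [retrGen_c_one, hD.map_ι]
    simp only [Dval, map_add, map_sum, apply_ite (retr K m), map_smul, map_mul, map_zero, retr_ι,
      retrGen_c_zero, retrGen_c_one]
    rfl
  | c (p + 2) i j =>
    have hS : ∀ b, D b = signElt K m * (signElt K m * D b) := fun b => by
      rw [← mul_assoc, signElt_mul_self, one_mul]
    rw [hD.map_ι, retrGen, map_smul, hD.map_mul_e, hD.map_e_mul, totalRetr, map_smul, hS,
      hD.signElt_mul_map_total_pow_odd, ← mul_smul_comm (catalan (p + 1) : K),
      ← sum_totalRetr_mul_totalRetr, ← mul_assoc, e_mul_signElt, smul_mul_assoc, smul_mul_assoc, smul_smul, sgn_mul_self,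
      one_smul]
    simp only [Dval, map_sum, map_smul, map_mul, retr_ι, retrGen, sum_component_mul_component,
      Finset.mul_sum, Finset.sum_mul]

lemma IsDiff.map_retr (x : IAlg K n) : D (retr K m x) = retr K m (D x) := by
  induction x using induction_left with
  | h1 => rw [_root_.map_one, hD.map_one, map_zero]
  | hadd a b ha hb => rw [map_add, map_add, ha, hb, map_add, map_add]
  | hsmul t a ha => rw [map_smul, map_smul, ha, map_smul, map_smul]
  | hmul g b hb =>
    rw [map_mul, retr_ι, hD.2.2 _ _ _ (retrGen_mem_Hgr m g), hD.2.2 _ _ _ (ι_mem_Hgr m g), hb,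
      hD.map_retrGen, map_add, map_smul, map_mul, map_mul, retr_ι]

end Differential

end InternalAlgebra

open InternalAlgebra

/-- The `k_n`-algebra homomorphism `r : I_n → I_n` defined on the
generators by `r(c^0_{ij}) = c^0_{ij}`, `r(c^1_{ij}) = c^1_{ij}` and, for `p > 1`, by the
Catalan-number formula, takes values in `A_n`, restricts to the identity on `A_n`, and
commutes with the differential `∂`.  Hence `r` is a DG-algebra retraction of `I_n` onto
its DG-subalgebra `A_n`. -/
theorem statement1 (K : Type) [Field K] (n : ℕ) (hn : 1 ≤ n) (m : Fin n → ℤ)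
    (D : IAlg K n →ₗ[K] IAlg K n) (hD : IsDiff K n m D) :
    ∃ r : IAlg K n →ₐ[K] IAlg K n,
      IsRetr K n m r ∧
      (∀ x : IAlg K n, r x ∈ Asub K n) ∧
      (∀ x : IAlg K n, x ∈ Asub K n → r x = x) ∧
      (∀ x : IAlg K n, D (r x) = r (D x)) := by
  exact ⟨retr K m, isRetr_retr m, retr_mem_Asub m, fun _ => retr_eq_self m, hD.map_retr⟩
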